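/- Let (W,S) be a Coxeter system with S finite, with geometric realization σ : W → GL(E) and root system Φ = Φ⁺ ⊔ Φ⁻. Let s ∈ S and x, y ∈ W with ℓ(xs) > ℓ(x) and ℓ(sy) > ℓ(y). Set A₂ := y⁻¹.Φ_x \ Φ_y⁻ and B₂ := (y⁻¹s).Φ_x \ Φ_y⁻. Then for every β ∈ A₂ \ B₂ one has (y⁻¹sy).β ∈ B₂ \ A₂; in particular β ↦ (y⁻¹sy).β defines an injection of A₂ \ B₂ into B₂ \ A₂, so card(A₂ \ B₂) ≤ card(B₂ \ A₂). -/

import Mathlib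

/-- The symmetric bilinear form on `E = B → ℝ` attached to a Coxeter matrix `M`:
`(e_i, e_j) = -cos (π / m_{ij})`, interpreted as `-1` when `m_{ij} = 0` (infinite order). -/
noncomputable def geomForm {B : Type*} [Fintype B] (M : CoxeterMatrix B)
    (f g : B → ℝ) : ℝ :=
  ∑ i, ∑ j, f i * g j *
    (if M i j = 0 then (-1 : ℝ) else -Real.cos (Real.pi / (M i j)))

/-- The set of roots `Φ = {x.e_s : x ∈ W, s ∈ S}` of the geometric realization `σ`. -/
def rootSet {B W : Type*} [DecidableEq B] [Group W]
    (σ : W →* ((B → ℝ) ≃ₗ[ℝ] (B → ℝ))) : Set (B → ℝ) :=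
  {v | ∃ (w : W) (i : B), σ w (Pi.single i 1) = v}

/-- The set of positive roots `Φ⁺`: roots which are nonnegative linear combinations
of the basis vectors `e_s`. -/
def posRoots {B W : Type*} [DecidableEq B] [Group W]
    (σ : W →* ((B → ℝ) ≃ₗ[ℝ] (B → ℝ))) : Set (B → ℝ) :=
  {v ∈ rootSet σ | ∀ i, 0 ≤ v i}

/-- The set of negative roots `Φ⁻ = -Φ⁺`. -/
def negRoots {B W : Type*} [DecidableEq B] [Group W]
    (σ : W →* ((B → ℝ) ≃ₗ[ℝ] (B → ℝ))) : Set (B → ℝ) :=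
  {v | -v ∈ posRoots σ}

/-- The inversion set `Φ_x = {α ∈ Φ⁺ : x.α ∈ Φ⁻}`. -/
def invSet {B W : Type*} [DecidableEq B] [Group W]
    (σ : W →* ((B → ℝ) ≃ₗ[ℝ] (B → ℝ))) (x : W) : Set (B → ℝ) :=
  {α ∈ posRoots σ | σ x α ∈ negRoots σ}

/-- The set `Φ_x⁻ = -Φ_x`. -/
def minusInvSet {B W : Type*} [DecidableEq B] [Group W]
    (σ : W →* ((B → ℝ) ≃ₗ[ℝ] (B → ℝ))) (x : W) : Set (B → ℝ) :=
  {v | -v ∈ invSet σ x}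

section GeometricRealization

variable {B W : Type*} [Fintype B] [DecidableEq B] [Group W] {M : CoxeterMatrix B}

open CoxeterSystem

lemma geomForm_single_single (i j : B) :
    geomForm M (Pi.single i 1) (Pi.single j 1) =
      if M i j = 0 then (-1 : ℝ) else -Real.cos (Real.pi / (M i j)) := by
  unfold geomForm
  rw [Finset.sum_eq_single i, Finset.sum_eq_single j]
  · simp
  · intro b _ hb
    simp [hb]
  · simp
  · intro b _ hb
    simp [hb]
  · simp

lemma geomForm_single_self (i : B) : geomForm M (Pi.single i 1) (Pi.single i 1) = 1 := by
  simp [geomForm_single_single]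

lemma geomForm_single_comm (i j : B) :
    geomForm M (Pi.single i 1) (Pi.single j 1) = geomForm M (Pi.single j 1) (Pi.single i 1) := by
  simp only [geomForm_single_single, M.symmetric i j]

/-- The coefficients of the roots of a rank two root subsystem whose two simple roots
generate a dihedral group of order `2 * m`, infinite if `m = 0`. -/
noncomputable def dihedralCoeff (m k : ℕ) : ℝ :=
  if m = 0 then k else Real.sin (k * (Real.pi / m)) / Real.sin (Real.pi / m)

lemma sin_pi_div_pos {m : ℕ} (hm : 2 ≤ m) : 0 < Real.sin (Real.pi / m) := by
  have h : (2 : ℝ) ≤ m := by exact_mod_cast hm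
  apply Real.sin_pos_of_pos_of_lt_pi
  · have := Real.pi_pos
    positivity
  · rw [div_lt_iff₀ (by linarith)]
    nlinarith [Real.pi_pos]

lemma dihedralCoeff_nonneg {m k : ℕ} (hm : m ≠ 1) (hk : m ≠ 0 → k ≤ m) :
    0 ≤ dihedralCoeff m k := by
  unfold dihedralCoeff
  split_ifs with h0
  · positivity
  · refine div_nonneg (Real.sin_nonneg_of_nonneg_of_le_pi ?_ ?_)
      (sin_pi_div_pos (by omega)).le
    · have := Real.pi_pos
      positivity
    · have hk' : (k : ℝ) ≤ m := by exact_mod_cast hk h0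
      have hm0 : (0 : ℝ) < m := by positivity
      rw [← mul_div_assoc, div_le_iff₀ hm0]
      nlinarith [Real.pi_pos]

lemma dihedralCoeff_zero (m : ℕ) : dihedralCoeff m 0 = 0 := by
  simp [dihedralCoeff]

lemma dihedralCoeff_one {m : ℕ} (hm : m ≠ 1) : dihedralCoeff m 1 = 1 := by
  unfold dihedralCoeff
  split_ifs with h0
  · simp
  · simpa using div_self (sin_pi_div_pos (by omega)).ne'

lemma dihedralCoeff_add_two (i j : B) (k : ℕ) :
    dihedralCoeff (M i j) (k + 2) =
      -(2 * geomForm M (Pi.single i 1) (Pi.single j 1)) * dihedralCoeff (M i j) (k + 1) -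
        dihedralCoeff (M i j) k := by
  rw [geomForm_single_single]
  unfold dihedralCoeff
  split_ifs with h0
  · push_cast
    ring
  · have e₁ : ((k + 2 : ℕ) : ℝ) * (Real.pi / (M i j)) =
        ((k + 1 : ℕ) : ℝ) * (Real.pi / (M i j)) + Real.pi / (M i j) := by
      push_cast
      ring
    have e₂ : (k : ℝ) * (Real.pi / (M i j)) =
        ((k + 1 : ℕ) : ℝ) * (Real.pi / (M i j)) - Real.pi / (M i j) := by
      push_cast
      ring
    rw [e₁, e₂, Real.sin_add, Real.sin_sub]
    ring

variable (cs : CoxeterSystem M W) (σ : W →* ((B → ℝ) ≃ₗ[ℝ] (B → ℝ)))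

omit [Fintype B] [DecidableEq B] in
/-- `w` factors as `v` times an alternating word, with lengths adding up and `v` of minimal
length in its coset of the standard parabolic subgroup generated by `i` and `j`. -/
lemma exists_eq_mul_alternatingWord (i j : B) (w : W) (hw : ¬ cs.IsRightDescent w i) :
    ∃ (v : W) (k : ℕ), w = v * cs.wordProd (alternatingWord i j k) ∧
      cs.length w = cs.length v + k ∧ ¬ cs.IsRightDescent v i ∧ ¬ cs.IsRightDescent v j := by
  induction h : cs.length w generalizing w i j with
  | zero =>
    refine ⟨w, 0, by simp [alternatingWord], by simp [h], hw, ?_⟩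
    simp [IsRightDescent, h]
  | succ n ih =>
    by_cases hj : cs.IsRightDescent w j
    · have hl := cs.isRightDescent_iff.1 hj
      obtain ⟨v, k, hv, hk, hvj, hvi⟩ := ih j i (w * cs.simple j)
        (cs.isRightDescent_iff_not_isRightDescent_mul.1 hj) (by omega)
      refine ⟨v, k + 1, ?_, by omega, hvi, hvj⟩
      rw [alternatingWord_succ, List.concat_eq_append, wordProd_append, ← mul_assoc, ← hv]
      simp
    · exact ⟨w, 0, by simp [alternatingWord], by simp [h], hw, hj⟩

variable {σ} (hσ : ∀ (i : B) (e : B → ℝ),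
  σ (cs.simple i) e = e - (2 * geomForm M e (Pi.single i 1)) • (Pi.single i 1 : B → ℝ))
include hσ

lemma map_alternatingWord_single {i j : B} (hij : i ≠ j) (k : ℕ) :
    σ (cs.wordProd (alternatingWord i j k)) (Pi.single i 1) =
      dihedralCoeff (M i j) (k + 1) • (Pi.single (if Even k then i else j) 1 : B → ℝ) +
      dihedralCoeff (M i j) k • (Pi.single (if Even k then j else i) 1 : B → ℝ) := by
  induction k with
  | zero =>
    simp [alternatingWord, dihedralCoeff_zero, dihedralCoeff_one (M.off_diagonal i j hij)]
  | succ k ih =>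
    rw [alternatingWord_succ', wordProd_cons, map_mul, LinearEquiv.mul_apply, ih, map_add,
      map_smul, map_smul, hσ, hσ, geomForm_single_self, dihedralCoeff_add_two]
    by_cases hk : Even k
    · simp only [hk, if_true, Nat.even_add_one, not_true, if_false]
      module
    · simp only [hk, if_true, Nat.even_add_one, not_false_iff, if_false]
      rw [geomForm_single_comm j i]
      module

/-- If `ℓ(ws) > ℓ(w)` then `w.e_s` is positive. -/
lemma map_single_nonneg (w : W) (i : B) (hw : ¬ cs.IsRightDescent w i) :
    0 ≤ σ w (Pi.single i 1) := by
  induction h : cs.length w using Nat.strong_induction_on generalizing w i with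
  | _ n ih =>
    by_cases h1 : w = 1
    · simp [h1]
    obtain ⟨j, hj⟩ := cs.exists_rightDescent_of_ne_one h1
    have hij : i ≠ j := by
      rintro rfl
      exact hw hj
    obtain ⟨v, k, hv, hk, hvi, hvj⟩ := exists_eq_mul_alternatingWord cs i j w hw
    have hk0 : k ≠ 0 := by
      rintro rfl
      simp only [alternatingWord, wordProd_nil, mul_one] at hv
      exact hvj (hv ▸ hj)
    have hkM : M i j ≠ 0 → k + 1 ≤ M i j := by
      intro hM
      by_contra! hlt
      have hnr := cs.not_isReduced_alternatingWord j i (m := k + 1)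
        (by rwa [M.symmetric j i]) (by rw [M.symmetric j i]; omega)
      apply hnr
      have h₁ := cs.not_isRightDescent_iff.1 hw
      have h₂ := cs.length_wordProd_le (alternatingWord j i (k + 1))
      have h₃ : w * cs.simple i = v * cs.wordProd (alternatingWord j i (k + 1)) := by
        rw [alternatingWord_succ, List.concat_eq_append, wordProd_append, ← mul_assoc, ← hv]
        simp
      have h₄ := cs.length_mul_le v (cs.wordProd (alternatingWord j i (k + 1)))
      rw [← h₃] at h₄
      unfold CoxeterSystem.IsReduced
      rw [length_alternatingWord] at h₂ ⊢
      omega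
    have hi := ih _ (by omega) v i hvi rfl
    have hj' := ih _ (by omega) v j hvj rfl
    rw [hv, map_mul, LinearEquiv.mul_apply, map_alternatingWord_single cs hσ hij, map_add,
      map_smul, map_smul]
    have hm := M.off_diagonal i j hij
    refine add_nonneg (smul_nonneg (dihedralCoeff_nonneg hm hkM) ?_)
      (smul_nonneg (dihedralCoeff_nonneg hm fun h ↦ (Nat.le_succ k).trans (hkM h)) ?_) <;>
    split_ifs <;> assumption

lemma nonneg_or_neg_nonneg {v : B → ℝ} (hv : v ∈ rootSet σ) : 0 ≤ v ∨ 0 ≤ -v := by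
  obtain ⟨w, i, rfl⟩ := hv
  by_cases h : cs.IsRightDescent w i
  · right
    have := map_single_nonneg cs hσ _ i (cs.isRightDescent_iff_not_isRightDescent_mul.1 h)
    rw [map_mul, LinearEquiv.mul_apply, hσ, geomForm_single_self] at this
    convert this using 1
    rw [← map_neg]
    congr 1
    module
  · exact Or.inl (map_single_nonneg cs hσ w i h)

lemma neg_mem_rootSet {v : B → ℝ} (hv : v ∈ rootSet σ) : -v ∈ rootSet σ := by
  obtain ⟨w, i, rfl⟩ := hv
  refine ⟨w * cs.simple i, i, ?_⟩
  rw [map_mul, LinearEquiv.mul_apply, hσ, geomForm_single_self, ← map_neg]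
  congr 1
  module

omit [Fintype B] hσ in
lemma map_mem_rootSet {v : B → ℝ} (hv : v ∈ rootSet σ) (w : W) : σ w v ∈ rootSet σ := by
  obtain ⟨u, i, rfl⟩ := hv
  exact ⟨w * u, i, by simp⟩

omit [Fintype B] hσ in
lemma ne_zero_of_mem_rootSet {v : B → ℝ} (hv : v ∈ rootSet σ) : v ≠ 0 := by
  obtain ⟨u, i, rfl⟩ := hv
  simp

/-- A simple reflection `s` with `ℓ(xs) > ℓ(x)` keeps the inversions of `x` positive. -/
lemma map_simple_nonneg_of_mem_invSet {i : B} {x : W} (hx : ¬ cs.IsRightDescent x i)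
    {γ : B → ℝ} (hγ : γ ∈ invSet σ x) : 0 ≤ σ (cs.simple i) γ := by
  obtain ⟨⟨hγr, hγ0⟩, -, hxγ⟩ := hγ
  refine (nonneg_or_neg_nonneg cs hσ (map_mem_rootSet hγr _)).resolve_right fun hneg ↦ ?_
  have hγi : γ = γ i • (Pi.single i 1 : B → ℝ) := by
    ext j
    by_cases hj : j = i
    · subst hj
      simp
    · have h := hneg j
      rw [hσ] at h
      simp only [Pi.zero_apply, Pi.neg_apply, Pi.sub_apply, Pi.smul_apply, smul_eq_mul,
        Pi.single_eq_of_ne hj, mul_zero, sub_zero] at h ⊢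
      linarith [hγ0 j]
  have h₁ : 0 ≤ σ x γ := by
    rw [hγi, map_smul]
    exact smul_nonneg (hγ0 i) (map_single_nonneg cs hσ x i hx)
  exact ne_zero_of_mem_rootSet (map_mem_rootSet hγr x)
    (le_antisymm (neg_nonneg.1 hxγ) h₁)

/-- If `ℓ(xs) > ℓ(x)` and `γ` is an inversion of `x` for which `s.γ` is not an inversion of `x`,
then `(γ, e_s) < 0`. -/
lemma geomForm_neg_of_mem_invSet {i : B} {x : W} (hx : ¬ cs.IsRightDescent x i)
    {γ : B → ℝ} (hγ : γ ∈ invSet σ x) (hsγ : σ (cs.simple i) γ ∉ invSet σ x) :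
    geomForm M γ (Pi.single i 1) < 0 := by
  have hpos := map_simple_nonneg_of_mem_invSet cs hσ hx hγ
  obtain ⟨⟨hγr, -⟩, -, hxγ⟩ := hγ
  by_contra! hc
  have hsr := map_mem_rootSet hγr (cs.simple i)
  refine hsγ ⟨⟨hsr, hpos⟩, neg_mem_rootSet cs hσ (map_mem_rootSet hsr x), ?_⟩
  change 0 ≤ -(σ x (σ (cs.simple i) γ))
  rw [hσ, map_sub, map_smul, neg_sub, sub_eq_add_neg]
  exact add_nonneg (smul_nonneg (by linarith) (map_single_nonneg cs hσ x i hx)) hxγ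

end GeometricRealization

/-- Let `s ∈ S` and `x, y ∈ W` with `ℓ(xs) > ℓ(x)` and
`ℓ(sy) > ℓ(y)`.  Set `A₂ := y⁻¹.Φ_x \ Φ_y⁻` and `B₂ := (y⁻¹s).Φ_x \ Φ_y⁻`.
Then `β ↦ (y⁻¹sy).β` maps `A₂ \ B₂` into `B₂ \ A₂` injectively, so
`card (A₂ \ B₂) ≤ card (B₂ \ A₂)`. -/
theorem card_diff_le_card_diff_two
    {B W : Type*} [Fintype B] [DecidableEq B] [Group W]
    {M : CoxeterMatrix B} (cs : CoxeterSystem M W)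
    (σ : W →* ((B → ℝ) ≃ₗ[ℝ] (B → ℝ)))
    (hσ : ∀ (i : B) (e : B → ℝ),
      σ (cs.simple i) e = e - (2 * geomForm M e (Pi.single i 1)) • (Pi.single i 1 : B → ℝ))
    (i : B) (x y : W)
    (hx : cs.length (x * cs.simple i) > cs.length x)
    (hy : cs.length (cs.simple i * y) > cs.length y)
    (A₂ B₂ : Set (B → ℝ))
    (hA₂ : A₂ = (σ y⁻¹) '' invSet σ x \ minusInvSet σ y)
    (hB₂ : B₂ = (σ (y⁻¹ * cs.simple i)) '' invSet σ x \ minusInvSet σ y) :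
    (∀ β ∈ A₂ \ B₂, σ (y⁻¹ * cs.simple i * y) β ∈ B₂ \ A₂) ∧
    Set.InjOn (σ (y⁻¹ * cs.simple i * y)) (A₂ \ B₂) ∧
    Cardinal.mk ↥(A₂ \ B₂) ≤ Cardinal.mk ↥(B₂ \ A₂) := by
  have hinj : Set.InjOn (σ (y⁻¹ * cs.simple i * y)) (A₂ \ B₂) :=
    (σ (y⁻¹ * cs.simple i * y)).injective.injOn
  have hmaps : ∀ β ∈ A₂ \ B₂, σ (y⁻¹ * cs.simple i * y) β ∈ B₂ \ A₂ := by
    subst hA₂ hB₂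
    have hx' : ¬ cs.IsRightDescent x i := not_lt.2 hx.le
    have hy' : ¬ cs.IsRightDescent y⁻¹ i := by
      rw [cs.isRightDescent_inv_iff]
      exact not_lt.2 hy.le
    rintro _ ⟨⟨⟨γ, hγ, rfl⟩, hβ⟩, hβB⟩
    have hsγ : σ (cs.simple i) γ ∉ invSet σ x := fun h ↦
      hβB ⟨⟨_, h, by simp [← LinearEquiv.mul_apply, ← map_mul]⟩, hβ⟩
    have hγr : γ ∈ rootSet σ := hγ.1.1
    have hyγ : 0 ≤ σ y⁻¹ γ := by
      have hr := map_mem_rootSet hγr y⁻¹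
      refine (nonneg_or_neg_nonneg cs hσ hr).resolve_right fun hneg ↦ hβ ?_
      refine ⟨⟨neg_mem_rootSet cs hσ hr, hneg⟩, ?_⟩
      change -(σ y (-(σ y⁻¹ γ))) ∈ posRoots σ
      simpa [← LinearEquiv.mul_apply, ← map_mul] using hγ.1
    have himage : σ (y⁻¹ * cs.simple i * y) (σ y⁻¹ γ) = σ y⁻¹ (σ (cs.simple i) γ) := by
      simp only [← LinearEquiv.mul_apply, ← map_mul, mul_inv_cancel_right]
    have hpos : 0 ≤ σ y⁻¹ (σ (cs.simple i) γ) := by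
      have hc := geomForm_neg_of_mem_invSet cs hσ hx' hγ hsγ
      rw [hσ, map_sub, map_smul, sub_eq_add_neg, ← neg_smul]
      exact add_nonneg hyγ (smul_nonneg (by linarith) (map_single_nonneg cs hσ _ i hy'))
    rw [himage]
    refine ⟨⟨⟨γ, hγ, by simp⟩, fun h ↦ ?_⟩, ?_⟩
    · have hneg : 0 ≤ -(σ y⁻¹ (σ (cs.simple i) γ)) := h.1.2
      exact ne_zero_of_mem_rootSet (map_mem_rootSet (map_mem_rootSet hγr _) _)
        (le_antisymm (neg_nonneg.1 hneg) hpos)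
    · rintro ⟨⟨δ, hδ, hδe⟩, -⟩
      exact hsγ ((σ y⁻¹).injective hδe ▸ hδ)
  exact ⟨hmaps, hinj, Cardinal.mk_le_of_injective
    (f := fun β ↦ ⟨_, hmaps β.1 β.2⟩)
    fun a b h ↦ Subtype.ext (hinj a.2 b.2 (congrArg Subtype.val h))⟩
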